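/- Let k > 0 and l > 0, and let u₀ : ℝ → ℝ be the 1-periodic odd function defined on [-1/2,1/2] by u₀(x) = 4k(2x - tanh(lx)/tanh(l/2)). Then the enstrophy satisfies the exact identity E(u₀) = (1/2)∫_{-1/2}^{1/2} u₀'(x)² dx = k² ( (32 l (cosh(l) + 2))/(3 sinh(l)) - 32 ). -/

import Mathlib

open MeasureTheory intervalIntegral Set Real

theorem Real.hasDerivAt_tanh_one_sub_sq (x : ℝ) :
    HasDerivAt Real.tanh (1 - Real.tanh x ^ 2) x := by
  have hc : Real.cosh x ≠ 0 := (Real.cosh_pos x).ne'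
  have h := (Real.hasDerivAt_sinh x).div (Real.hasDerivAt_cosh x) hc
  have hfun : Real.tanh = Real.sinh / Real.cosh := by
    funext y
    exact Real.tanh_eq_sinh_div_cosh y
  rw [hfun]
  refine h.congr_deriv ?_
  simp only [Pi.div_apply]
  field_simp

theorem Real.hasDerivAt_tanh_const_mul (l x : ℝ) :
    HasDerivAt (fun y => Real.tanh (l * y)) ((1 - Real.tanh (l * x) ^ 2) * l) x := by
  have h := (hasDerivAt_id x).const_mul l
  rw [mul_one] at h
  exact (Real.hasDerivAt_tanh_one_sub_sq (l * x)).comp x h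

theorem Real.continuous_tanh_const_mul (l : ℝ) : Continuous fun y => Real.tanh (l * y) :=
  continuous_iff_continuousAt.2 fun x => (Real.hasDerivAt_tanh_const_mul l x).continuousAt

/-- The squared slope of `4k(2x - tanh(lx)/T)`, integrated over one period. -/
theorem integral_sq_deriv_shock_profile (k l T : ℝ) :
    ∫ x in (-(1:ℝ)/2)..(1/2),
        (4 * k * (2 - (1 - Real.tanh (l * x) ^ 2) * l / T)) ^ 2 =
      16 * k ^ 2 * (4 - 8 * Real.tanh (l / 2) / T +
        2 * l * (Real.tanh (l / 2) - Real.tanh (l / 2) ^ 3 / 3) / T ^ 2) := by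
  have hderiv : ∀ x : ℝ, HasDerivAt
      (fun y => 16 * k ^ 2 * (4 * y - 4 * Real.tanh (l * y) / T +
        l * (Real.tanh (l * y) - Real.tanh (l * y) ^ 3 / 3) / T ^ 2))
      ((4 * k * (2 - (1 - Real.tanh (l * x) ^ 2) * l / T)) ^ 2) x := by
    intro x
    have ht := Real.hasDerivAt_tanh_const_mul l x
    have h := ((((hasDerivAt_id x).const_mul 4).sub ((ht.const_mul 4).div_const T)).add
      (((ht.sub ((ht.pow 3).div_const 3)).const_mul l).div_const (T ^ 2))).const_mul (16 * k ^ 2)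
    refine h.congr_deriv ?_
    push_cast
    ring
  have hcont : Continuous fun x =>
      (4 * k * (2 - (1 - Real.tanh (l * x) ^ 2) * l / T)) ^ 2 := by
    have := Real.continuous_tanh_const_mul l
    fun_prop
  rw [integral_eq_sub_of_hasDerivAt (fun x _ => hderiv x) (hcont.intervalIntegrable _ _)]
  have hneg : Real.tanh (l * (-(1:ℝ) / 2)) = -Real.tanh (l / 2) := by
    rw [← Real.tanh_neg]
    congr 1
    ring
  rw [hneg, mul_one_div l]
  ring

/-- Exact enstrophy of the initial data `u₀(x) = 4k(2x - tanh(lx)/tanh(l/2))`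
(extended 1-periodically from `[-1/2,1/2]`):
`E(u₀) = k²(32l(cosh l + 2)/(3 sinh l) - 32)`. -/
theorem enstrophy_initial_data_exact (k l : ℝ) (hk : 0 < k) (hl : 0 < l)
    (u₀ : ℝ → ℝ)
    (hper : ∀ x : ℝ, u₀ (x + 1) = u₀ x)
    (hformula : ∀ x ∈ Set.Icc (-(1:ℝ)/2) (1/2),
      u₀ x = 4 * k * (2 * x - Real.tanh (l * x) / Real.tanh (l / 2))) :
    (1/2) * ∫ x in (-(1:ℝ)/2)..(1/2), (deriv u₀ x) ^ 2 =
      k ^ 2 * ((32 * l * (Real.cosh l + 2)) / (3 * Real.sinh l) - 32) := by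
  have hu : ∀ x ∈ Ioo (-(1:ℝ)/2) (1/2), deriv u₀ x =
      4 * k * (2 - (1 - Real.tanh (l * x) ^ 2) * l / Real.tanh (l / 2)) := by
    intro x hx
    have h := (((hasDerivAt_id x).const_mul 2).sub
      ((Real.hasDerivAt_tanh_const_mul l x).div_const (Real.tanh (l / 2)))).const_mul (4 * k)
    rw [mul_one] at h
    refine (h.congr_of_eventuallyEq ?_).deriv
    filter_upwards [Ioo_mem_nhds hx.1 hx.2] with y hy
    exact hformula y (Ioo_subset_Icc_self hy)
  have hint : ∫ x in (-(1:ℝ)/2)..(1/2), (deriv u₀ x) ^ 2 = ∫ x in (-(1:ℝ)/2)..(1/2),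
      (4 * k * (2 - (1 - Real.tanh (l * x) ^ 2) * l / Real.tanh (l / 2))) ^ 2 := by
    rw [integral_of_le (by norm_num), integral_of_le (by norm_num),
      integral_Ioc_eq_integral_Ioo, integral_Ioc_eq_integral_Ioo]
    refine setIntegral_congr_fun measurableSet_Ioo fun x hx => ?_
    simp only [hu x hx]
  rw [hint, integral_sq_deriv_shock_profile]
  have hs : Real.sinh (l / 2) ≠ 0 := (Real.sinh_pos_iff.2 (half_pos hl)).ne'
  have hc : Real.cosh (l / 2) ≠ 0 := (Real.cosh_pos _).ne'
  have hsinh : Real.sinh l = 2 * Real.sinh (l / 2) * Real.cosh (l / 2) := by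
    rw [← Real.sinh_two_mul, mul_div_cancel₀ l two_ne_zero]
  have hcosh : Real.cosh l + 2 = 3 * Real.cosh (l / 2) ^ 2 - Real.sinh (l / 2) ^ 2 := by
    have h := Real.cosh_two_mul (l / 2)
    rw [mul_div_cancel₀ l two_ne_zero] at h
    linear_combination h - 2 * Real.cosh_sq_sub_sinh_sq (l / 2)
  rw [hcosh, hsinh, Real.tanh_eq_sinh_div_cosh]
  field_simp
  ring
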